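/- Let e ≥ 2, r ≥ 1, and let (λ, s) ∈ Λ^(r) × ℤ^r be an r-tuple of abacus configurations that is not a Rouquier multipartition. Then Ψ_r(λ, s) is not an r-Rouquier partition. Consequently, if (μ, t) is an r-Rouquier partition then Φ_r(μ, t) is a Rouquier multipartition. -/

import Mathlib

/-- A partition: a weakly decreasing sequence of non-negative integers,
eventually zero.  `part i` is the `(i+1)`-st part `λ_{i+1}`. -/
structure PartitionSeq where
  part : ℕ → ℕ
  antitone : ∀ i j : ℕ, i ≤ j → part j ≤ part i
  eventually_zero : ∃ N : ℕ, ∀ i : ℕ, N ≤ i → part i = 0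

/-- The empty partition. -/
def zeroPart : PartitionSeq := ⟨fun _ => 0, fun _ _ _ => le_rfl, ⟨0, fun _ _ => rfl⟩⟩

/-- A β-set: a set of integers containing all sufficiently small integers and
excluding all sufficiently large ones. -/
def IsBetaSet (B : Set ℤ) : Prop :=
  (∃ N : ℤ, ∀ z : ℤ, z < N → z ∈ B) ∧ (∃ M : ℤ, ∀ z : ℤ, M < z → z ∉ B)

/-- The β-set `B_s(λ) = {λ_i - i + s : i ≥ 1}`. -/
def betaSet (lam : PartitionSeq) (s : ℤ) : Set ℤ :=
  {b : ℤ | ∃ i : ℕ, b = (lam.part i : ℤ) - ((i : ℤ) + 1) + s}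

/-- `|λ|`, the sum of the parts of a partition. -/
noncomputable def psize (lam : PartitionSeq) : ℕ := ∑ᶠ i, lam.part i

/-- The pair `(λ, s)` corresponding to a β-set (junk value if none exists). -/
noncomputable def partOfBeta (B : Set ℤ) : PartitionSeq × ℤ :=
  letI := Classical.propDecidable (∃ p : PartitionSeq × ℤ, betaSet p.1 p.2 = B)
  if h : ∃ p : PartitionSeq × ℤ, betaSet p.1 p.2 = B then h.choose else (zeroPart, 0)

/-- The β-set `C_i` of runner `i`: the rows `m` with a bead at position `m*e+i`. -/
def quotSetB (e : ℕ) (B : Set ℤ) (i : ℕ) : Set ℤ :=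
  {m : ℤ | m * (e : ℤ) + (i : ℤ) ∈ B}

/-- `ρ_i`: the `i`-th component of the `e`-quotient of the configuration `B`. -/
noncomputable def rhoB (e : ℕ) (B : Set ℤ) (i : ℕ) : PartitionSeq :=
  (partOfBeta (quotSetB e B i)).1

/-- `t_i`: the charge of runner `i` of the configuration `B`. -/
noncomputable def tB (e : ℕ) (B : Set ℤ) (i : ℕ) : ℤ :=
  (partOfBeta (quotSetB e B i)).2

/-- `|ρ| = Σ_i |ρ_i|`, the size of the `e`-quotient of `B`. -/
noncomputable def wtB (e : ℕ) (B : Set ℤ) : ℕ :=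
  ∑ i ∈ Finset.range e, psize (rhoB e B i)

/-- `B` is a (`c`-shifted) Rouquier configuration: `wt ≤ t_{i+1} - t_i + c`
for all `0 ≤ i < e-1`.  `c = 1` gives Rouquier, `c = r` gives `r`-Rouquier. -/
def IsRouquierB (e : ℕ) (B : Set ℤ) (c : ℤ) : Prop :=
  ∀ i : ℕ, i + 1 < e → (wtB e B : ℤ) ≤ tB e B (i + 1) - tB e B i + c

/-- Uglov's map `ψ_k`: sends `me + i` (with `0 ≤ i < e`) to `((m+1)r - k)e + i`. -/
def psi (e r k x : ℤ) : ℤ := ((Int.ediv x e + 1) * r - k) * e + Int.emod x e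

/-- Uglov's map `Ψ_r` on β-sets: `⨆_{k=1}^r ψ_k(B_k)`. -/
def uglovSet (e r : ℕ) (B : Fin r → Set ℤ) : Set ℤ :=
  ⋃ k : Fin r, psi (e : ℤ) (r : ℤ) (((k : ℕ) : ℤ) + 1) '' B k

/-- The number of nodes of the Young diagram of `λ` with `e`-residue `j`
(for charge `0`). -/
noncomputable def resCount (e : ℕ) (lam : PartitionSeq) (j : ZMod e) : ℕ :=
  {p : ℕ × ℕ | p.2 < lam.part p.1 ∧ ((p.2 : ZMod e) - (p.1 : ZMod e) = j)}.ncard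

/-- The block relation `λ ∼_e μ` for partitions: equal size and equal
multisets of `e`-residues. -/
def SimE (e : ℕ) (lam mu : PartitionSeq) : Prop :=
  psize lam = psize mu ∧ ∀ j : ZMod e, resCount e lam j = resCount e mu j

/-- The number of nodes of the Young diagram of a multipartition with
`e`-residue `j`, for the multicharge `s`. -/
noncomputable def mresCount (e : ℕ) {r : ℕ} (lam : Fin r → PartitionSeq)
    (s : Fin r → ℤ) (j : ZMod e) : ℕ :=
  ∑ k : Fin r, {p : ℕ × ℕ |
    p.2 < (lam k).part p.1 ∧ ((s k : ZMod e) + (p.2 : ZMod e) - (p.1 : ZMod e) = j)}.ncard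

/-- The block relation `(λ, s) ≈_e (μ, s)` for multipartitions with the same
multicharge: equal size and equal multisets of `e`-residues. -/
def MSimE (e : ℕ) {r : ℕ} (lam mu : Fin r → PartitionSeq) (s : Fin r → ℤ) : Prop :=
  (∑ k, psize (lam k)) = (∑ k, psize (mu k)) ∧
    ∀ j : ZMod e, mresCount e lam s j = mresCount e mu s j

/-- The `e`-core abacus configuration of `B`: all beads pushed up on their
runners. -/
noncomputable def eCoreSet (e : ℕ) (B : Set ℤ) : Set ℤ :=
  {b : ℤ | ∃ i : ℕ, i < e ∧ ∃ m : ℤ, m < tB e B i ∧ b = m * (e : ℤ) + (i : ℤ)}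

/-- The `e`-core of `λ` (computed via the abacus with charge `s`). -/
noncomputable def eCore (e : ℕ) (lam : PartitionSeq) (s : ℤ) : PartitionSeq :=
  (partOfBeta (eCoreSet e (betaSet lam s))).1

/-- The `e`-weight of `λ`: `(|λ| - |e-core(λ)|)/e`. -/
noncomputable def eWeight (e : ℕ) (lam : PartitionSeq) (s : ℤ) : ℤ :=
  ((psize lam : ℤ) - (psize (eCore e lam s) : ℤ)) / (e : ℤ)

/-- Replace the bead at position `b` by a bead at position `c`. -/
def replaceBead (S : Set ℤ) (b c : ℤ) : Set ℤ := insert c (S \ {b})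

/-- Perform two bead replacements, `b₁ ↦ c₁` in component `k₁` and then
`b₂ ↦ c₂` in component `k₂`. -/
def twoBeadUpdate {ι : Type*} [DecidableEq ι] (B : ι → Set ℤ)
    (k₁ : ι) (b₁ c₁ : ℤ) (k₂ : ι) (b₂ c₂ : ℤ) : ι → Set ℤ :=
  Function.update (Function.update B k₁ (replaceBead (B k₁) b₁ c₁)) k₂
    (replaceBead (Function.update B k₁ (replaceBead (B k₁) b₁ c₁) k₂) b₂ c₂)

/-- Type-1 move at level `N`: decrease a β-number by `N` in component `k₁`
and increase a β-number by `N` in component `k₂`. -/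
def Move1 {ι : Type*} [DecidableEq ι] (N : ℤ) (B B' : ι → Set ℤ) : Prop :=
  ∃ k₁ k₂ : ι, ∃ b₁ b₂ : ℤ,
    b₁ ∈ B k₁ ∧ b₁ - N ∉ B k₁ ∧ b₂ ∈ B k₂ ∧ b₂ + N ∉ B k₂ ∧
    B' = twoBeadUpdate B k₁ b₁ (b₁ - N) k₂ b₂ (b₂ + N)

/-- Type-2 move at level `N`: for `b₁ ≡ b₂ (mod N)` and `h > 0`, replace `b₁`
by `b₁ + h` in component `k₁` and `b₂ + h` by `b₂` in component `k₂`. -/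
def Move2 {ι : Type*} [DecidableEq ι] (N : ℤ) (B B' : ι → Set ℤ) : Prop :=
  ∃ k₁ k₂ : ι, ∃ b₁ b₂ h : ℤ, 0 < h ∧ ((N : ℤ) ∣ b₁ - b₂) ∧
    b₁ ∈ B k₁ ∧ b₁ + h ∉ B k₁ ∧ b₂ ∉ B k₂ ∧ b₂ + h ∈ B k₂ ∧
    B' = twoBeadUpdate B k₁ b₁ (b₁ + h) k₂ (b₂ + h) b₂

/-- The block relation on tuples of abacus configurations: the reflexive
transitive closure of type-1 and type-2 moves at level `N`. -/
def BlockEq {ι : Type*} [DecidableEq ι] (N : ℤ) (B B' : ι → Set ℤ) : Prop :=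
  Relation.ReflTransGen (fun X Y => Move1 N X Y ∨ Move2 N X Y) B B'

/-- The stretching operation on a single abacus configuration: shift the
content of runner `i` by `M i`, leaving the `e`-quotient unchanged. -/
def strSet (e : ℕ) (M : ℕ → ℤ) (B : Set ℤ) : Set ℤ :=
  {b : ℤ | ∃ i : ℕ, i < e ∧ ∃ m : ℤ, m * (e : ℤ) + (i : ℤ) ∈ B ∧
    b = (m + M i) * (e : ℤ) + (i : ℤ)}

theorem exists_betaSet_eq {B : Set ℤ} (hB : IsBetaSet B) :
    ∃ p : PartitionSeq × ℤ, betaSet p.1 p.2 = B := by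
  classical
  obtain ⟨⟨N, hN⟩, ⟨M, hM⟩⟩ := hB
  set P : ℕ → Prop := fun n => M - n ∈ B with hP
  set n₀ : ℕ := (M - N).toNat + 1 with hn₀
  have hlarge : ∀ n, n₀ ≤ n → P n := fun n hn => hN _ (by omega)
  have hinf : (Set.ofPred P).Infinite := by
    refine Set.infinite_of_not_bddAbove ?_
    rintro ⟨b, hb⟩
    have := hb (show P (n₀ + b + 1) from hlarge _ (by omega))
    omega
  have hmono := Nat.nth_strictMono hinf
  set c : ℕ := Nat.count P n₀ with hc
  have hcount : ∀ d : ℕ, Nat.count P (n₀ + d) = c + d := by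
    intro d
    induction d with
    | zero => rfl
    | succ d ih =>
      rw [← Nat.add_assoc, Nat.count_succ, if_pos (hlarge _ (by omega)), ih]
      omega
  have htail : ∀ i, c ≤ i → Nat.nth P i + c = n₀ + i := by
    intro i hi
    have h1 := hcount (i - c)
    have h2 := Nat.nth_count (hlarge (n₀ + (i - c)) (by omega))
    rw [h1, show c + (i - c) = i by omega] at h2
    omega
  have hgap : ∀ i j, i ≤ j → Nat.nth P i + (j - i) ≤ Nat.nth P j := by
    intro i j hij
    induction j, hij using Nat.le_induction with
    | base => simp
    | succ j hj ih =>
      have := hmono (Nat.lt_succ_self j)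
      simp only [Nat.succ_eq_add_one] at this
      omega
  have hle : ∀ i, Nat.nth P i + c ≤ n₀ + i := by
    intro i
    have h1 := hgap i (max i c) (le_max_left _ _)
    have h2 := htail (max i c) (le_max_right _ _)
    omega
  refine ⟨⟨⟨fun i => n₀ + i - c - Nat.nth P i, ?_, ⟨c, ?_⟩⟩, M - n₀ + c + 1⟩, ?_⟩
  · intro i j hij
    have := hgap i j hij
    have := hle i
    have := hle j
    omega
  · intro i hi
    have := htail i hi
    omega
  · ext b
    simp only [betaSet, Set.mem_ofPred_eq]
    have key : ∀ i : ℕ, ((n₀ + i - c - Nat.nth P i : ℕ) : ℤ) - ((i : ℤ) + 1) + (M - n₀ + c + 1) =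
        M - (Nat.nth P i : ℕ) := by
      intro i
      have := hle i
      omega
    simp only [key]
    constructor
    · rintro ⟨i, rfl⟩
      exact Nat.nth_mem_of_infinite hinf i
    · intro hb
      have hbM : b ≤ M := not_lt.1 fun h => hM b h hb
      have hPb : P (M - b).toNat := by
        simp only [hP]
        rwa [Int.toNat_of_nonneg (by omega), sub_sub_cancel]
      refine ⟨Nat.count P (M - b).toNat, ?_⟩
      rw [Nat.nth_count hPb]
      omega

theorem betaSet_partOfBeta {B : Set ℤ} (hB : IsBetaSet B) :
    betaSet (partOfBeta B).1 (partOfBeta B).2 = B := by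
  have h := exists_betaSet_eq hB
  rw [partOfBeta, dif_pos h]
  exact h.choose_spec

theorem PartitionSeq.exists_forall_part_eq_zero (lam : PartitionSeq) (s : ℤ) :
    ∃ N : ℕ, s ≤ N ∧ ∀ i, N ≤ i → lam.part i = 0 := by
  obtain ⟨n, hn⟩ := lam.eventually_zero
  exact ⟨max n s.toNat, by omega, fun i hi => hn i (by omega)⟩

theorem isBetaSet_betaSet (lam : PartitionSeq) (s : ℤ) : IsBetaSet (betaSet lam s) := by
  obtain ⟨N, -, hN⟩ := lam.exists_forall_part_eq_zero 0
  refine ⟨⟨s - N, fun z hz => ⟨(s - 1 - z).toNat, ?_⟩⟩, ⟨lam.part 0 + s, ?_⟩⟩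
  · rw [hN _ (by omega)]
    omega
  · rintro z hz ⟨i, rfl⟩
    have := lam.antitone 0 i (Nat.zero_le i)
    omega

theorem IsBetaSet.preimage_affine {B : Set ℤ} (hB : IsBetaSet B) {a : ℤ} (ha : 0 < a) (c : ℤ) :
    IsBetaSet {m : ℤ | m * a + c ∈ B} := by
  obtain ⟨⟨N, hN⟩, ⟨M, hM⟩⟩ := hB
  refine ⟨⟨-|N - c|, fun z hz => hN _ ?_⟩, ⟨|M - c|, fun z hz => hM _ ?_⟩⟩
  · have := neg_abs_le (N - c)
    have := abs_nonneg (N - c)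
    nlinarith
  · have := le_abs_self (M - c)
    have := abs_nonneg (M - c)
    nlinarith

/-- The indicator of `B` minus that of the negative integers, which has finite support when `B` is
a β-set. -/
noncomputable def relIndicator (B : Set ℤ) (z : ℤ) : ℤ :=
  B.indicator 1 z - (Set.Iio 0).indicator 1 z

/-- The regularized sum of `φ` over the beads of `B`. -/
noncomputable def beadSum (φ : ℤ → ℤ) (B : Set ℤ) : ℤ :=
  ∑ᶠ z, φ z * relIndicator B z

theorem IsBetaSet.finite_support {B : Set ℤ} (hB : IsBetaSet B) (φ : ℤ → ℤ) :
    (fun z => φ z * relIndicator B z).HasFiniteSupport := by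
  obtain ⟨⟨N, hN⟩, ⟨M, hM⟩⟩ := hB
  refine (Set.finite_Icc (min N 0) (max M 0)).subset fun z hz => ?_
  by_contra hcon
  apply hz
  simp only [Set.mem_Icc, not_and_or, not_le] at hcon
  rcases hcon with h | h
  · simp [relIndicator, hN z (by omega), show z < 0 by omega]
  · simp [relIndicator, hM z (by omega), show ¬ z < 0 by omega]

theorem beadSum_add (φ χ : ℤ → ℤ) {B : Set ℤ} (hB : IsBetaSet B) :
    beadSum (fun z => φ z + χ z) B = beadSum φ B + beadSum χ B := by
  simp only [beadSum, add_mul]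
  exact finsum_add_distrib (hB.finite_support φ) (hB.finite_support χ)

theorem beadSum_const_mul (a : ℤ) (φ : ℤ → ℤ) (B : Set ℤ) :
    beadSum (fun z => a * φ z) B = a * beadSum φ B := by
  simp only [beadSum, mul_assoc]
  exact (mul_finsum _ _).symm

theorem indicator_betaSet (lam : PartitionSeq) (s : ℤ) (N : ℕ)
    (hN : ∀ i, N ≤ i → lam.part i = 0) (z : ℤ) :
    (betaSet lam s).indicator (1 : ℤ → ℤ) z =
      (∑ i ∈ Finset.range N, if z = (lam.part i : ℤ) - ((i : ℤ) + 1) + s then 1 else 0) +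
        (Set.Iio (s - N)).indicator 1 z := by
  have hinj : ∀ i j : ℕ, (lam.part i : ℤ) - ((i : ℤ) + 1) + s =
      (lam.part j : ℤ) - ((j : ℤ) + 1) + s → i = j := by
    intro i j h
    rcases le_total i j with hij | hij
    · have := lam.antitone i j hij
      omega
    · have := lam.antitone j i hij
      omega
  by_cases hz : z ∈ betaSet lam s
  · rw [Set.indicator_of_mem hz]
    obtain ⟨i, rfl⟩ := hz
    simp only [Pi.one_apply]
    by_cases hi : i < N
    · rw [Finset.sum_eq_single_of_mem i (Finset.mem_range.2 hi)
        (fun j _ hj => if_neg fun h => hj (hinj i j h).symm), if_pos rfl,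
        Set.indicator_of_notMem, add_zero]
      simp only [Set.mem_Iio]
      omega
    · rw [Finset.sum_eq_zero, Set.indicator_of_mem, Pi.one_apply, zero_add]
      · simp only [Set.mem_Iio]
        rw [hN i (by omega)]
        omega
      · intro j hj
        refine if_neg fun h => ?_
        have := hinj i j h
        have := Finset.mem_range.1 hj
        omega
  · rw [Set.indicator_of_notMem hz, Finset.sum_eq_zero, Set.indicator_of_notMem, add_zero]
    · simp only [Set.mem_Iio]
      intro h
      refine hz ⟨(s - 1 - z).toNat, ?_⟩
      rw [hN _ (by omega)]
      omega
    · exact fun j _ => if_neg fun h => hz ⟨j, h⟩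

theorem betaSet_zeroPart : betaSet zeroPart 0 = Set.Iio 0 := by
  ext z
  simp only [betaSet, zeroPart, Set.mem_ofPred_eq, Set.mem_Iio]
  constructor
  · rintro ⟨i, rfl⟩
    omega
  · intro h
    exact ⟨(-1 - z).toNat, by omega⟩

theorem beadSum_betaSet (φ : ℤ → ℤ) (lam : PartitionSeq) (s : ℤ) (N K : ℕ)
    (hN : ∀ i, N ≤ i → lam.part i = 0) (hK : (K : ℤ) = N - s) :
    beadSum φ (betaSet lam s) =
      ∑ i ∈ Finset.range N, φ ((lam.part i : ℤ) - ((i : ℤ) + 1) + s) -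
        ∑ i ∈ Finset.range K, φ (-((i : ℤ) + 1)) := by
  have hfin : ∀ (n : ℕ) (f : ℕ → ℤ),
      (fun z => ∑ i ∈ Finset.range n, φ z * if z = f i then 1 else 0).HasFiniteSupport := by
    intro n f
    refine ((Finset.range n).finite_toSet.image f).subset fun z hz => ?_
    obtain ⟨i, hi, h⟩ := Finset.exists_ne_zero_of_sum_ne_zero hz
    refine ⟨i, hi, ?_⟩
    by_contra hne
    exact h (by rw [if_neg fun h => hne h.symm, mul_zero])
  have hsum : ∀ (n : ℕ) (f : ℕ → ℤ),
      ∑ᶠ z, ∑ i ∈ Finset.range n, φ z * (if z = f i then 1 else 0) =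
        ∑ i ∈ Finset.range n, φ (f i) := by
    intro n f
    rw [finsum_sum_comm]
    · refine Finset.sum_congr rfl fun i _ => ?_
      rw [finsum_eq_single _ (f i) fun z hz => by rw [if_neg hz, mul_zero], if_pos rfl, mul_one]
    · intro i _
      refine (Set.finite_singleton (f i)).subset fun z hz => ?_
      by_contra hne
      exact hz (by simp only; rw [if_neg (show ¬ z = f i from hne), mul_zero])
  have h0 := indicator_betaSet zeroPart 0 K (fun _ _ => rfl)
  rw [betaSet_zeroPart] at h0
  simp only [zeroPart, Nat.cast_zero, zero_sub, add_zero] at h0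
  rw [← hsum N, ← hsum K fun i => -((i : ℤ) + 1),
    ← finsum_sub_distrib (hfin N _) (hfin K _), beadSum]
  refine finsum_congr fun z => ?_
  rw [relIndicator, indicator_betaSet lam s N hN, h0, hK, neg_sub, ← Finset.mul_sum,
    ← Finset.mul_sum]
  ring

theorem beadSum_one_betaSet (lam : PartitionSeq) (s : ℤ) :
    beadSum (fun _ => 1) (betaSet lam s) = s := by
  obtain ⟨N, hs, hN⟩ := lam.exists_forall_part_eq_zero s
  rw [beadSum_betaSet _ lam s N (N - s).toNat hN (by omega)]
  simp
  omega

theorem beadSum_id_betaSet (lam : PartitionSeq) (s : ℤ) :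
    2 * beadSum (fun z => z) (betaSet lam s) = 2 * psize lam + s * (s - 1) := by
  obtain ⟨N, hs, hN⟩ := lam.exists_forall_part_eq_zero s
  obtain ⟨K, hK⟩ : ∃ K : ℕ, (K : ℤ) = N - s := ⟨(N - s).toNat, by omega⟩
  have hsize : psize lam = ∑ i ∈ Finset.range N, lam.part i := by
    refine finsum_eq_sum_of_support_subset _ fun i hi => ?_
    by_contra h
    exact hi (hN i (by simpa using h))
  have hgauss : ∀ n : ℕ, 2 * ∑ i ∈ Finset.range n, ((i : ℤ) + 1) = n * (n + 1) := by
    intro n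
    induction n with
    | zero => simp
    | succ n ih =>
      rw [Finset.sum_range_succ, mul_add, ih]
      push_cast
      ring
  rw [beadSum_betaSet _ lam s N K hN hK, hsize]
  have h1 := hgauss N
  have h2 := hgauss K
  simp only [Finset.sum_add_distrib, Finset.sum_sub_distrib, Finset.sum_neg_distrib,
    Finset.sum_const, Finset.card_range, nsmul_eq_mul, Nat.cast_sum] at h1 h2 ⊢
  rw [hK] at h2
  linear_combination -h1 + h2 + 2 * hK

theorem relIndicator_mul_add {r : ℕ} (k : Fin r) (B : Set ℤ) (m : ℤ) :
    relIndicator B (m * r + (k : ℕ)) = relIndicator {m : ℤ | m * r + (k : ℕ) ∈ B} m := by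
  have hk := k.isLt
  have hneg : m * r + ((k : ℕ) : ℤ) < 0 ↔ m < 0 := by
    constructor
    · intro h
      by_contra hm
      nlinarith
    · intro h
      nlinarith
  have hind : B.indicator (1 : ℤ → ℤ) (m * r + (k : ℕ)) =
      {m : ℤ | m * r + (k : ℕ) ∈ B}.indicator 1 m :=
    rfl
  have hind₀ : (Set.Iio 0).indicator (1 : ℤ → ℤ) (m * r + (k : ℕ)) =
      (Set.Iio 0).indicator 1 m := by
    by_cases hm : m < 0
    · rw [Set.indicator_of_mem (Set.mem_Iio.2 (hneg.2 hm)),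
        Set.indicator_of_mem (Set.mem_Iio.2 hm), Pi.one_apply, Pi.one_apply]
    · rw [Set.indicator_of_notMem fun h => hm (hneg.1 (Set.mem_Iio.1 h)),
        Set.indicator_of_notMem fun h => hm (Set.mem_Iio.1 h)]
  rw [relIndicator, relIndicator, hind, hind₀]

theorem beadSum_eq_sum_mul_add {r : ℕ} (hr : 1 ≤ r) (φ : ℤ → ℤ) {B : Set ℤ} (hB : IsBetaSet B) :
    beadSum φ B = ∑ k : Fin r,
      beadSum (fun m => φ (m * r + (k : ℕ))) {m : ℤ | m * r + (k : ℕ) ∈ B} := by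
  have : NeZero r := ⟨by omega⟩
  have hfin : ((fun z => φ z * relIndicator B z) ∘
      ((Equiv.prodComm _ _).trans (Int.divModEquiv r).symm)).HasFiniteSupport := by
    rw [Function.HasFiniteSupport, Function.support_comp_eq_preimage]
    exact (hB.finite_support φ).preimage (Equiv.injective _).injOn
  rw [beadSum, ← finsum_comp_equiv ((Equiv.prodComm _ _).trans (Int.divModEquiv r).symm)]
  refine (finsum_curry _ hfin).trans ?_
  rw [finsum_eq_sum_of_fintype]
  refine Finset.sum_congr rfl fun k _ => finsum_congr fun m => ?_
  simp [Int.divModEquiv, relIndicator_mul_add]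

theorem beadSum_eq_sum {r : ℕ} (hr : 1 ≤ r) (φ : ℤ → ℤ) {B : Set ℤ} (hB : IsBetaSet B) :
    beadSum φ B = ∑ k : Fin r, beadSum (fun m => φ (r * m + (r - 1 - (k : ℕ))))
      {m : ℤ | m * r + (r - 1 - (k : ℕ)) ∈ B} := by
  rw [beadSum_eq_sum_mul_add hr φ hB, ← Equiv.sum_comp Fin.revPerm]
  refine Finset.sum_congr rfl fun k _ => ?_
  have hk := k.isLt
  have hrev : (((Fin.revPerm k : Fin r) : ℕ) : ℤ) = r - 1 - (k : ℕ) := by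
    simp only [Fin.revPerm_apply, Fin.val_rev]
    omega
  simp only [hrev, mul_comm]

theorem beadSum_one_eq_charge {B : Set ℤ} (hB : IsBetaSet B) :
    beadSum (fun _ => 1) B = (partOfBeta B).2 := by
  conv_lhs => rw [← betaSet_partOfBeta hB]
  exact beadSum_one_betaSet _ _

theorem beadSum_id_eq_size {B : Set ℤ} (hB : IsBetaSet B) :
    2 * beadSum (fun z => z) B =
      2 * psize (partOfBeta B).1 + (partOfBeta B).2 * ((partOfBeta B).2 - 1) := by
  conv_lhs => rw [← betaSet_partOfBeta hB]
  exact beadSum_id_betaSet _ _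

/-- Twice the size of the `r`-core with charges `a` on its runners. -/
def coreEnergy {r : ℕ} (a : Fin r → ℤ) : ℤ :=
  ∑ k, (r * (a k * (a k - 1)) + 2 * ((r - 1 - (k : ℕ)) * a k)) - (∑ k, a k) * (∑ k, a k - 1)

section Decompose

variable {r : ℕ} {C : Set ℤ} {D : Fin r → Set ℤ}

theorem charge_eq_sum (hr : 1 ≤ r) (hC : IsBetaSet C) (hD : ∀ k, IsBetaSet (D k))
    (h : ∀ k : Fin r, D k = {m : ℤ | m * r + (r - 1 - (k : ℕ)) ∈ C}) :
    (partOfBeta C).2 = ∑ k, (partOfBeta (D k)).2 := by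
  rw [← beadSum_one_eq_charge hC, beadSum_eq_sum hr _ hC]
  refine Finset.sum_congr rfl fun k _ => ?_
  rw [← h, beadSum_one_eq_charge (hD k)]

theorem two_mul_size_eq (hr : 1 ≤ r) (hC : IsBetaSet C) (hD : ∀ k, IsBetaSet (D k))
    (h : ∀ k : Fin r, D k = {m : ℤ | m * r + (r - 1 - (k : ℕ)) ∈ C}) :
    2 * (psize (partOfBeta C).1 : ℤ) =
      2 * r * ∑ k, (psize (partOfBeta (D k)).1 : ℤ) +
        coreEnergy fun k => (partOfBeta (D k)).2 := by
  have hterm : ∀ k : Fin r, 2 * beadSum (fun m => r * m + (r - 1 - (k : ℕ))) (D k) =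
      2 * r * (psize (partOfBeta (D k)).1 : ℤ) +
        (r * ((partOfBeta (D k)).2 * ((partOfBeta (D k)).2 - 1)) +
          2 * ((r - 1 - (k : ℕ)) * (partOfBeta (D k)).2)) := by
    intro k
    have hconst : beadSum (fun _ => (r : ℤ) - 1 - (k : ℕ)) (D k) =
        (r - 1 - (k : ℕ)) * (partOfBeta (D k)).2 := by
      rw [← beadSum_one_eq_charge (hD k), ← beadSum_const_mul]
      simp
    rw [beadSum_add _ _ (hD k), beadSum_const_mul, hconst]
    linear_combination (r : ℤ) * beadSum_id_eq_size (hD k)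
  have hsize := beadSum_id_eq_size hC
  rw [beadSum_eq_sum hr _ hC] at hsize
  simp only [← h] at hsize
  rw [Finset.mul_sum, Finset.sum_congr rfl fun k _ => hterm k, Finset.sum_add_distrib,
    ← Finset.mul_sum, charge_eq_sum hr hC hD h] at hsize
  rw [coreEnergy]
  linear_combination -hsize

end Decompose

/-- The contribution of the pair of runners `k`, `l` to the size of a core. -/
def pairEnergy {r : ℕ} (a : Fin r → ℤ) (k l : Fin r) : ℤ :=
  (a k - a l) * (a k - a l + ((if k < l then 1 else 0) - if l < k then 1 else 0))

theorem pairEnergy_comm {r : ℕ} (a : Fin r → ℤ) (k l : Fin r) :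
    pairEnergy a k l = pairEnergy a l k := by
  unfold pairEnergy
  ring

theorem pairEnergy_nonneg {r : ℕ} (a : Fin r → ℤ) (k l : Fin r) : 0 ≤ pairEnergy a k l := by
  unfold pairEnergy
  rcases lt_trichotomy (a k - a l) 0 with h | h | h
  · refine mul_nonneg_of_nonpos_of_nonpos h.le ?_
    split_ifs <;> omega
  · simp [h]
  · refine mul_nonneg h.le ?_
    split_ifs <;> omega

theorem two_mul_coreEnergy {r : ℕ} (a : Fin r → ℤ) :
    2 * coreEnergy a = ∑ k, ∑ l, pairEnergy a k l := by
  have hsign : ∀ k : Fin r,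
      ∑ l : Fin r, ((if k < l then (1 : ℤ) else 0) - if l < k then 1 else 0) =
        r - 1 - 2 * (k : ℕ) := by
    intro k
    have hk := k.isLt
    have h1 := Fin.card_Ioi k
    have h2 := Fin.card_Iio k
    rw [Finset.sum_sub_distrib, Finset.sum_boole, Finset.sum_boole, Finset.filter_lt_eq_Ioi,
      Finset.filter_gt_eq_Iio, h1, h2]
    omega
  have hexpand : ∀ k l : Fin r, pairEnergy a k l =
      a k ^ 2 + a l ^ 2 - 2 * (a k * a l) +
        (a k * ((if k < l then 1 else 0) - if l < k then 1 else 0) +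
          a l * ((if l < k then 1 else 0) - if k < l then 1 else 0)) := by
    intro k l
    unfold pairEnergy
    ring
  have hswap : ∑ k : Fin r, ∑ l : Fin r,
      a l * ((if l < k then (1 : ℤ) else 0) - if k < l then 1 else 0) =
        ∑ k : Fin r, a k * (r - 1 - 2 * (k : ℕ)) := by
    rw [Finset.sum_comm]
    exact Finset.sum_congr rfl fun k _ => by rw [← Finset.mul_sum, hsign]
  simp only [hexpand, Finset.sum_add_distrib, Finset.sum_sub_distrib, hswap, ← Finset.mul_sum,
    hsign, Finset.sum_const, Finset.card_univ, Fintype.card_fin, nsmul_eq_mul, ← Finset.sum_mul]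
  have hcore : coreEnergy a = r * ∑ k, a k ^ 2 + ∑ k : Fin r, a k * (r - 1 - 2 * (k : ℕ)) -
      (∑ k, a k) * (∑ k, a k) := by
    have hlin : ∀ k : Fin r, r * (a k * (a k - 1)) + 2 * ((r - 1 - (k : ℕ)) * a k) =
        r * a k ^ 2 + a k * (r - 1 - 2 * (k : ℕ)) - a k := fun k => by ring
    rw [coreEnergy, Finset.sum_congr rfl fun k _ => hlin k, Finset.sum_sub_distrib,
      Finset.sum_add_distrib, Finset.mul_sum]
    ring
  rw [hcore]
  ring

theorem coreEnergy_nonneg {r : ℕ} (a : Fin r → ℤ) : 0 ≤ coreEnergy a := by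
  have := two_mul_coreEnergy a
  have : 0 ≤ ∑ k, ∑ l, pairEnergy a k l :=
    Finset.sum_nonneg fun k _ => Finset.sum_nonneg fun l _ => pairEnergy_nonneg a k l
  omega

theorem sum_pairEnergy_le_coreEnergy {r : ℕ} (a : Fin r → ℤ) (j : Fin r) :
    ∑ l, pairEnergy a j l ≤ coreEnergy a := by
  have hself : pairEnergy a j j = 0 := by simp [pairEnergy]
  have h1 := Finset.sum_erase_add Finset.univ (fun k => ∑ l, pairEnergy a k l) (Finset.mem_univ j)
  have h2 := Finset.sum_erase_add Finset.univ (fun k => pairEnergy a j k) (Finset.mem_univ j)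
  have h3 : ∑ k ∈ Finset.univ.erase j, pairEnergy a j k ≤
      ∑ k ∈ Finset.univ.erase j, ∑ l, pairEnergy a k l := by
    refine Finset.sum_le_sum fun k _ => ?_
    rw [pairEnergy_comm]
    exact Finset.single_le_sum (fun l _ => pairEnergy_nonneg a k l) (Finset.mem_univ j)
  have h4 := two_mul_coreEnergy a
  simp only [hself] at h2
  linarith

theorem mul_add_one_nonneg (x : ℤ) : 0 ≤ x * (x + 1) := by
  rcases lt_or_ge x 0 with h | h
  · exact mul_nonneg_of_nonpos_of_nonpos h.le (by omega)
  · positivity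

theorem le_pairEnergy_add_pairEnergy {r : ℕ} (a b : Fin r → ℤ) (j l : Fin r) :
    2 * ((b l - a l) - (b j - a j) - 1) + (if l = j then 2 else 0) ≤
      pairEnergy a j l + pairEnergy b j l := by
  unfold pairEnergy
  rcases lt_trichotomy j l with h | h | h
  · rw [if_pos h, if_neg h.not_gt, if_neg h.ne']
    nlinarith [mul_add_one_nonneg (a j - a l - 1), mul_add_one_nonneg (b j - b l + 1)]
  · subst h
    simp
  · rw [if_neg h.not_gt, if_pos h, if_neg h.ne]
    nlinarith [mul_add_one_nonneg (a j - a l - 2), mul_add_one_nonneg (b j - b l)]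

theorem le_coreEnergy_add_coreEnergy {r : ℕ} (a b : Fin r → ℤ) (j : Fin r) :
    2 * (∑ l, b l - ∑ l, a l - r * (b j - a j) - r + 1) ≤ coreEnergy a + coreEnergy b := by
  have h := Finset.sum_le_sum fun l (_ : l ∈ Finset.univ) => le_pairEnergy_add_pairEnergy a b j l
  simp only [Finset.sum_add_distrib, Finset.sum_sub_distrib, ← Finset.mul_sum, Finset.sum_ite_eq',
    Finset.mem_univ, if_true, Finset.sum_const, Finset.card_univ, Fintype.card_fin,
    nsmul_eq_mul] at h
  have ha := sum_pairEnergy_le_coreEnergy a j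
  have hb := sum_pairEnergy_le_coreEnergy b j
  linarith

theorem psi_mul_add {e : ℕ} {i : ℕ} (hi : i < e) (r k m : ℤ) :
    psi e r (k + 1) (m * e + i) = (m * r + (r - 1 - k)) * e + i := by
  have hdiv : Int.ediv (m * e + i) e = m := by
    change (m * e + i) / (e : ℤ) = m
    rw [add_comm, Int.add_mul_ediv_right _ _ (by omega), Int.ediv_eq_zero_of_lt (by omega)
      (by omega), zero_add]
  have hmod : Int.emod (m * e + i) e = i := by
    change (m * e + i) % (e : ℤ) = i
    rw [add_comm, Int.add_mul_emod_self_right, Int.emod_eq_of_lt (by omega) (by omega)]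
  rw [psi, hdiv, hmod]
  ring

theorem IsRouquierB.psi_preimage {e r : ℕ} (hr : 1 ≤ r) {B : Set ℤ} (hB : IsBetaSet B)
    (hR : IsRouquierB e B r) (j : Fin r) : IsRouquierB e (psi e r ((j : ℕ) + 1) ⁻¹' B) 1 := by
  intro i hi
  set D : Fin r → Set ℤ := fun k => psi e r ((k : ℕ) + 1) ⁻¹' B with hDdef
  have hC : ∀ i, IsBetaSet (quotSetB e B i) := fun i => hB.preimage_affine (by omega) _
  have hDC : ∀ i < e, ∀ k : Fin r,
      quotSetB e (D k) i = {m : ℤ | m * r + (r - 1 - (k : ℕ)) ∈ quotSetB e B i} := by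
    intro i hi k
    ext m
    simp only [hDdef, quotSetB, Set.mem_ofPred_eq, Set.mem_preimage, psi_mul_add hi]
  have hD : ∀ i < e, ∀ k, IsBetaSet (quotSetB e (D k) i) := fun i hi k => by
    rw [hDC i hi k]
    exact (hC i).preimage_affine (by omega) _
  have hsize : ∀ i < e, 2 * (psize (rhoB e B i) : ℤ) =
      2 * r * ∑ k, (psize (rhoB e (D k) i) : ℤ) + coreEnergy fun k => tB e (D k) i :=
    fun i hi => two_mul_size_eq hr (hC i) (hD i hi) (hDC i hi)
  have hcharge : ∀ i < e, tB e B i = ∑ k, tB e (D k) i :=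
    fun i hi => charge_eq_sum hr (hC i) (hD i hi) (hDC i hi)
  have hcores : (coreEnergy fun k => tB e (D k) i) + (coreEnergy fun k => tB e (D k) (i + 1)) ≤
      ∑ i ∈ Finset.range e, coreEnergy fun k => tB e (D k) i := by
    rw [← Finset.sum_pair (f := fun i => coreEnergy fun k => tB e (D k) i)
      (show i ≠ i + 1 by omega)]
    refine Finset.sum_le_sum_of_subset_of_nonneg ?_ fun _ _ _ => coreEnergy_nonneg _
    intro x hx
    simp only [Finset.mem_insert, Finset.mem_singleton] at hx
    simp only [Finset.mem_range]
    omega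
  have hquot : (wtB e (D j) : ℤ) ≤
      ∑ i ∈ Finset.range e, ∑ k, (psize (rhoB e (D k) i) : ℤ) := by
    rw [wtB, Nat.cast_sum]
    exact Finset.sum_le_sum fun i _ => Finset.single_le_sum
      (f := fun k => (psize (rhoB e (D k) i) : ℤ)) (fun _ _ => by positivity) (Finset.mem_univ j)
  have hwt : 2 * (wtB e B : ℤ) = 2 * r * ∑ i ∈ Finset.range e, ∑ k, (psize (rhoB e (D k) i) : ℤ) +
      ∑ i ∈ Finset.range e, coreEnergy fun k => tB e (D k) i := by
    rw [wtB, Nat.cast_sum, Finset.mul_sum, Finset.mul_sum, ← Finset.sum_add_distrib]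
    exact Finset.sum_congr rfl fun i hi => hsize i (Finset.mem_range.1 hi)
  have henergy := le_coreEnergy_add_coreEnergy (fun k => tB e (D k) i)
    (fun k => tB e (D k) (i + 1)) j
  have hRi := hR i hi
  rw [hcharge i (by omega), hcharge (i + 1) hi] at hRi
  change (wtB e (D j) : ℤ) ≤ tB e (D j) (i + 1) - tB e (D j) i + 1
  by_contra hcon
  have hr' : (1 : ℤ) ≤ r := by exact_mod_cast hr
  have hquot' := mul_le_mul_of_nonneg_left hquot (show (0 : ℤ) ≤ r by omega)
  have hlt : (r : ℤ) * (tB e (D j) (i + 1) - tB e (D j) i + 2) ≤ r * wtB e (D j) :=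
    mul_le_mul_of_nonneg_left (by omega) (by omega)
  linarith

theorem exists_eq_mul_add {e : ℕ} (he : 0 < e) (x : ℤ) : ∃ (m : ℤ) (i : ℕ), i < e ∧
    x = m * e + i := by
  have h1 := Int.emod_nonneg x (show (e : ℤ) ≠ 0 by omega)
  have h2 := Int.emod_lt_of_pos x (show (0 : ℤ) < e by omega)
  refine ⟨x / e, (x % e).toNat, by omega, ?_⟩
  rw [Int.toNat_of_nonneg h1]
  exact (Int.ediv_mul_add_emod x e).symm

theorem mul_add_inj {e : ℕ} {m m' : ℤ} {i i' : ℕ} (hi : i < e) (hi' : i' < e)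
    (h : m * e + i = m' * e + i') : m = m' ∧ i = i' := by
  have hm : m = m' := by
    rcases lt_trichotomy m m' with hlt | heq | hlt
    · nlinarith
    · exact heq
    · nlinarith
  subst hm
  exact ⟨rfl, by omega⟩

theorem psi_inj {e r : ℕ} (he : 0 < e) {k l : Fin r} {x y : ℤ}
    (h : psi e r ((k : ℕ) + 1) x = psi e r ((l : ℕ) + 1) y) : k = l ∧ x = y := by
  obtain ⟨m, i, hi, rfl⟩ := exists_eq_mul_add he x
  obtain ⟨n, i', hi', rfl⟩ := exists_eq_mul_add he y
  rw [psi_mul_add hi, psi_mul_add hi'] at h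
  obtain ⟨hrow, rfl⟩ := mul_add_inj hi hi' h
  have hk := k.isLt
  have hl := l.isLt
  have hrow' : m * r + ((r - 1 - k : ℕ) : ℤ) = n * r + ((r - 1 - l : ℕ) : ℤ) := by
    rw [Nat.cast_sub (by omega), Nat.cast_sub (by omega), Nat.cast_sub (by omega),
      Nat.cast_sub (by omega)]
    push_cast
    exact hrow
  obtain ⟨rfl, hkl⟩ := mul_add_inj (e := r) (by omega) (by omega) hrow'
  exact ⟨Fin.ext (by omega), rfl⟩

theorem psi_preimage_uglovSet {e r : ℕ} (he : 0 < e) (B : Fin r → Set ℤ) (k : Fin r) :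
    psi e r ((k : ℕ) + 1) ⁻¹' uglovSet e r B = B k := by
  ext x
  simp only [uglovSet, Set.mem_preimage, Set.mem_iUnion, Set.mem_image]
  constructor
  · rintro ⟨l, y, hy, h⟩
    obtain ⟨rfl, rfl⟩ := psi_inj he h
    exact hy
  · exact fun hx => ⟨k, x, hx, rfl⟩

theorem exists_psi_eq {e r : ℕ} (he : 0 < e) (hr : 0 < r) (z : ℤ) :
    ∃ (k : Fin r) (m : ℤ) (i : ℕ), i < e ∧ z = psi e r ((k : ℕ) + 1) (m * e + i) ∧
      m * r * e ≤ z ∧ z < (m + 1) * r * e := by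
  obtain ⟨q, i, hi, rfl⟩ := exists_eq_mul_add he z
  obtain ⟨m, o, ho, rfl⟩ := exists_eq_mul_add hr q
  refine ⟨⟨r - 1 - o, by omega⟩, m, i, hi, ?_, by nlinarith, by nlinarith⟩
  rw [psi_mul_add hi]
  have : ((r - 1 - o : ℕ) : ℤ) = r - 1 - o := by omega
  simp only [this]
  ring

theorem isBetaSet_uglovSet {e r : ℕ} (he : 0 < e) (hr : 0 < r) {B : Fin r → Set ℤ}
    (hB : ∀ k, IsBetaSet (B k)) : IsBetaSet (uglovSet e r B) := by
  choose N hN M hM using fun k => show ∃ N : ℤ, (∀ z : ℤ, z < N → z ∈ B k) ∧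
    ∃ M : ℤ, ∀ z : ℤ, M < z → z ∉ B k from
      let ⟨⟨N, hN⟩, ⟨M, hM⟩⟩ := hB k; ⟨N, hN, M, hM⟩
  have hNle : ∀ k, |N k| ≤ ∑ k, |N k| := fun k =>
    Finset.single_le_sum (f := fun k => |N k|) (fun _ _ => abs_nonneg _) (Finset.mem_univ k)
  have hMle : ∀ k, |M k| ≤ ∑ k, |M k| := fun k =>
    Finset.single_le_sum (f := fun k => |M k|) (fun _ _ => abs_nonneg _) (Finset.mem_univ k)
  set N₀ := ∑ k, |N k|
  set M₀ := ∑ k, |M k|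
  have hpos : (0 : ℤ) < r * e := by positivity
  refine ⟨⟨-N₀ * (r * e), fun z hz => ?_⟩, ⟨(M₀ + 2) * (r * e), fun z hz => ?_⟩⟩ <;>
    obtain ⟨k, m, i, hi, rfl, hlo, hhi⟩ := exists_psi_eq he hr z <;>
    rw [← Set.mem_preimage, psi_preimage_uglovSet he]
  · have hm : m < -N₀ := by
      rw [mul_assoc] at hlo
      exact lt_of_mul_lt_mul_right (hlo.trans_lt hz) hpos.le
    have := neg_abs_le (N k)
    have := abs_nonneg (N k)
    have := hNle k
    refine hN k _ ?_
    nlinarith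
  · have hm : M₀ + 2 < m + 1 := by
      rw [mul_assoc] at hhi
      exact lt_of_mul_lt_mul_right (hz.trans hhi) hpos.le
    have := le_abs_self (M k)
    have := abs_nonneg (M k)
    have := hMle k
    refine hM k _ ?_
    nlinarith

theorem stmt13 (e r : ℕ) (he : 2 ≤ e) (hr : 1 ≤ r) :
    (∀ (lam : Fin r → PartitionSeq) (s : Fin r → ℤ),
      ¬ (∀ k : Fin r, IsRouquierB e (betaSet (lam k) (s k)) 1) →
        ¬ IsRouquierB e (uglovSet e r fun k => betaSet (lam k) (s k)) (r : ℤ)) ∧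
    (∀ (mu : PartitionSeq) (t : ℤ), IsRouquierB e (betaSet mu t) (r : ℤ) →
      ∀ k : Fin r,
        IsRouquierB e (psi (e : ℤ) (r : ℤ) (((k : ℕ) : ℤ) + 1) ⁻¹' betaSet mu t) 1) := by
  refine ⟨fun lam s hnot hR => hnot fun k => ?_, fun mu t hR k =>
    hR.psi_preimage hr (isBetaSet_betaSet mu t) k⟩
  have h := hR.psi_preimage hr (isBetaSet_uglovSet (by omega) hr fun k =>
    isBetaSet_betaSet (lam k) (s k)) k
  rwa [psi_preimage_uglovSet (by omega)] at h
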